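/- arXiv:1909.08678 — 3 statements merged into one kernel-verified Lean document; each statement's English description precedes it below -/
import Mathlib

section
/- Let r, s > 0, let τ ∈ [0,1), and set ε := min{r−τr, s−τs}. Then for all u, B ∈ ℝ³ and Π ∈ ℝ with |u+B| < τr + ε, |u−B| < τs + ε and |Π| < rs, the state (u, u⊗u − B⊗B + Π·Id, B, B×u) belongs to K_{r,s}^{lc,Λ}. -/
noncomputable section

/-- Vectors in ℝ³. -/
abbrev V3 : Type := Fin 3 → ℝ

/-- Euclidean inner product on ℝ³. -/
def dot3 (a b : V3) : ℝ := ∑ i, a i * b i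

/-- Cross product on ℝ³. -/
def cross3 (a b : V3) : V3 :=
  ![a 1 * b 2 - a 2 * b 1, a 2 * b 0 - a 0 * b 2, a 0 * b 1 - a 1 * b 0]

/-- Euclidean norm on ℝ³. -/
def eNorm3 (a : V3) : ℝ := Real.sqrt (∑ i, (a i) ^ 2)

/-- 3×3 real matrices. -/
abbrev Mat3 : Type := Matrix (Fin 3) (Fin 3) ℝ

/-- A state is a tuple V = (u, S, B, E). -/
abbrev MHDState : Type := V3 × Mat3 × V3 × V3

/-- The Euclidean norm on the state space. -/
def stateNorm (V : MHDState) : ℝ :=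
  Real.sqrt ((∑ i, (V.1 i) ^ 2) + (∑ i, ∑ j, (V.2.1 i j) ^ 2) +
    (∑ i, (V.2.2.1 i) ^ 2) + (∑ i, (V.2.2.2 i) ^ 2))

/-- ξ = (ξ_x, ξ_t) annihilates the state V = (u, S, B, E) if ξ_x·u = 0, ξ_x·B = 0,
ξ_t u + S ξ_x = 0 and ξ_t B + ξ_x × E = 0. -/
def Annihilates (ξx : V3) (ξt : ℝ) (V : MHDState) : Prop :=
  dot3 ξx V.1 = 0 ∧ dot3 ξx V.2.2.1 = 0 ∧
  ξt • V.1 + V.2.1.mulVec ξx = 0 ∧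
  ξt • V.2.2.1 + cross3 ξx V.2.2.2 = 0

/-- The wave cone Λ: states with symmetric S admitting some ξ with ξ_x ≠ 0
annihilating them. -/
def WaveCone : Set MHDState :=
  {V | V.2.1.IsSymm ∧ ∃ ξx : V3, ∃ ξt : ℝ, ξx ≠ 0 ∧ Annihilates ξx ξt V}

/-- The set ℳ of states (with symmetric S) satisfying B·E = 0. -/
def MSet : Set MHDState :=
  {V | V.2.1.IsSymm ∧ dot3 V.2.2.1 V.2.2.2 = 0}

/-- The segment [V₀ − (1−λ)V, V₀ + λV] is a good Λ-segment. -/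
def GoodSegment (V₀ V : MHDState) (lam : ℝ) : Prop :=
  V₀ ∈ MSet ∧ V ∈ WaveCone ∧ 0 < lam ∧ lam < 1 ∧
  (∀ t : ℝ, -(1 - lam) ≤ t → t ≤ lam → V₀ + t • V ∈ MSet) ∧
  ∃ ξx : V3, ∃ ξt : ℝ, ξx ≠ 0 ∧ Annihilates ξx ξt V ∧
    ((V.2.2.1 = 0 ∧ V.2.2.2 = 0) ∨
     (dot3 ξx V₀.2.2.1 ≠ 0 ∨ ξt • V₀.2.2.1 + cross3 ξx V₀.2.2.2 ≠ 0) ∨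
     (∃ k : ℝ, k ≠ -(1 / lam) ∧ k ≠ 1 / (1 - lam) ∧
       V.2.2.1 = k • V₀.2.2.1 ∧ V.2.2.2 = k • V₀.2.2.2 ∧
       ¬(V.2.2.1 = 0 ∧ V.2.2.2 = 0)) ∨
     (V.1 = 0 ∧ V.2.1 = 0 ∧ V₀.2.2.1 = 0 ∧ V₀.2.2.2 = 0))

/-- The iterated lamination sets Y^{N,Λ}. -/
def lamHull (Y : Set MHDState) : ℕ → Set MHDState
  | 0 => Y
  | N + 1 => lamHull Y N ∪
      {Z | ∃ lam : ℝ, ∃ V W : MHDState, 0 ≤ lam ∧ lam ≤ 1 ∧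
        V ∈ lamHull Y N ∧ W ∈ lamHull Y N ∧ V - W ∈ WaveCone ∧
        Z = lam • V + (1 - lam) • W}

/-- The lamination convex hull Y^{lc,Λ}. -/
def lcHull (Y : Set MHDState) : Set MHDState := ⋃ N : ℕ, lamHull Y N

/-- The iterated good lamination sets Y^{k,Λ_g}. -/
def lamHullG (Y : Set MHDState) : ℕ → Set MHDState
  | 0 => Y
  | k + 1 => lamHullG Y k ∪
      {V₀ | ∃ lam : ℝ, ∃ V : MHDState, GoodSegment V₀ V lam ∧
        V₀ + lam • V ∈ lamHullG Y k ∧ V₀ - (1 - lam) • V ∈ lamHullG Y k}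

/-- The good lamination convex hull Y^{lc,Λ_g}. -/
def lcHullG (Y : Set MHDState) : Set MHDState := ⋃ k : ℕ, lamHullG Y k

/-- A set of states is relatively open in ℳ. -/
def RelOpen (U : Set MHDState) : Prop :=
  ∀ V ∈ U, ∃ δ : ℝ, 0 < δ ∧ ∀ W ∈ MSet, stateNorm (W - V) < δ → W ∈ U

/-- The tensor product a⊗b of two vectors in ℝ³. -/
def outer (a b : V3) : Mat3 := Matrix.of fun i j => a i * b j

/-- The constitutive set K_{r,s}. -/
def Kset (r s : ℝ) : Set MHDState :=
  {V | ∃ q : ℝ, |q| ≤ r * s ∧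
    V.2.1 = outer V.1 V.1 - outer V.2.2.1 V.2.2.1 + q • (1 : Mat3) ∧
    V.2.2.2 = cross3 V.2.2.1 V.1 ∧
    eNorm3 (V.1 + V.2.2.1) = r ∧ eNorm3 (V.1 - V.2.2.1) = s}

/-- 𝒰_{r,s}: the relative interior of K_{r,s}^{lc,Λ} in ℳ. -/
def Uset (r s : ℝ) : Set MHDState :=
  {V | V ∈ MSet ∧ ∃ δ : ℝ, 0 < δ ∧
    ∀ W ∈ MSet, stateNorm (W - V) < δ → W ∈ lcHull (Kset r s)}

/-- The Frobenius norm on 3×3 matrices. -/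
def frobNorm (M : Mat3) : ℝ := Real.sqrt (∑ i, ∑ j, (M i j) ^ 2)

/-- The relatively open sets 𝒱_{r',s',c}. -/
def Vset (r' s' c : ℝ) : Set MHDState :=
  {V | V.2.1.IsSymm ∧ dot3 V.2.2.1 V.2.2.2 = 0 ∧ ∃ q : ℝ,
    eNorm3 (V.1 + V.2.2.1) < r' + c ∧ eNorm3 (V.1 - V.2.2.1) < s' + c ∧
    frobNorm (V.2.1 - (outer V.1 V.1 - outer V.2.2.1 V.2.2.1) - q • (1 : Mat3)) < c ∧
    |q| < r' * s' + c ∧ eNorm3 (V.2.2.2 - cross3 V.2.2.1 V.1) < c}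

/-- The state with velocity `u`, magnetic field `B` and pressure `q` satisfying the
constitutive relations. -/
def constState (q : ℝ) (u B : V3) : MHDState :=
  (u, outer u u - outer B B + q • (1 : Mat3), B, cross3 B u)

theorem exists_ne_zero_dot3_eq_zero (a : V3) : ∃ e : V3, e ≠ 0 ∧ dot3 e a = 0 := by
  by_cases h : a 0 = 0 ∧ a 1 = 0
  · refine ⟨![1, 0, 0], fun h0 => ?_, ?_⟩
    · simpa using congrFun h0 0
    · simp [dot3, Fin.sum_univ_three, h.1]
  · refine ⟨![-a 1, a 0, 0], fun h0 => h ⟨?_, ?_⟩, ?_⟩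
    · simpa using congrFun h0 1
    · simpa using congrFun h0 0
    · simp [dot3, Fin.sum_univ_three]
      ring

theorem sum_sq_pos_of_ne_zero {e : V3} (he : e ≠ 0) : 0 < ∑ i, e i ^ 2 := by
  obtain ⟨i, hi⟩ := Function.ne_iff.mp he
  exact Finset.sum_pos' (fun _ _ => sq_nonneg _) ⟨i, Finset.mem_univ i, sq_pos_iff.mpr hi⟩

theorem eNorm3_eq_of_sum_sq {a : V3} {r : ℝ} (hr : 0 ≤ r) (h : ∑ i, a i ^ 2 = r ^ 2) :
    eNorm3 a = r := by
  rw [eNorm3, h, Real.sqrt_sq hr]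

/-- Every point of a ball is the midpoint of a chord of the ball. -/
theorem exists_eNorm3_add_sub_eq {a : V3} {r : ℝ} (h : eNorm3 a ≤ r) :
    ∃ d : V3, eNorm3 (a + d) = r ∧ eNorm3 (a - d) = r := by
  have hr : 0 ≤ r := (Real.sqrt_nonneg _).trans h
  have h2 : ∑ i, a i ^ 2 ≤ r ^ 2 := (Real.sqrt_le_left hr).mp h
  obtain ⟨e, he, hea⟩ := exists_ne_zero_dot3_eq_zero a
  have hpos := sum_sq_pos_of_ne_zero he
  set t : ℝ := Real.sqrt ((r ^ 2 - ∑ i, a i ^ 2) / ∑ i, e i ^ 2)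
  have ht : t ^ 2 * ∑ i, e i ^ 2 = r ^ 2 - ∑ i, a i ^ 2 := by
    rw [Real.sq_sqrt (div_nonneg (sub_nonneg.mpr h2) hpos.le), div_mul_cancel₀ _ hpos.ne']
  clear_value t
  simp only [dot3, Fin.sum_univ_three] at hea ht
  refine ⟨t • e, eNorm3_eq_of_sum_sq hr ?_, eNorm3_eq_of_sum_sq hr ?_⟩ <;>
    simp only [Fin.sum_univ_three, Pi.add_apply, Pi.sub_apply, Pi.smul_apply, smul_eq_mul]
  · linear_combination ht + 2 * t * hea
  · linear_combination ht - 2 * t * hea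

theorem mem_lcHull_of_mem {Y : Set MHDState} {V : MHDState} (h : V ∈ Y) : V ∈ lcHull Y :=
  Set.mem_iUnion.mpr ⟨0, h⟩

theorem lamHull_mono (Y : Set MHDState) : Monotone (lamHull Y) :=
  monotone_nat_of_le_succ fun _ => Set.subset_union_left

theorem lcHull_of_sub_mem_waveCone {Y : Set MHDState} {V W : MHDState} (hV : V ∈ lcHull Y)
    (hW : W ∈ lcHull Y) (h : V - W ∈ WaveCone) {lam : ℝ} (h0 : 0 ≤ lam) (h1 : lam ≤ 1) :
    lam • V + (1 - lam) • W ∈ lcHull Y := by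
  obtain ⟨M, hM⟩ := Set.mem_iUnion.mp hV
  obtain ⟨N, hN⟩ := Set.mem_iUnion.mp hW
  exact Set.mem_iUnion.mpr ⟨max M N + 1, Or.inr ⟨lam, V, W, h0, h1,
    lamHull_mono Y (le_max_left M N) hM, lamHull_mono Y (le_max_right M N) hN, h, rfl⟩⟩

/-- Changing one of the Elsässer variables `u ± B` while keeping the other and the pressure
fixed is a wave cone direction. -/
theorem constState_sub_mem_waveCone (q σ : ℝ) (hσ : σ ^ 2 = 1) (u B d : V3) :
    constState q (u + d) (B + σ • d) - constState q (u - d) (B - σ • d) ∈ WaveCone := by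
  obtain ⟨ξ, hξ, hd⟩ := exists_ne_zero_dot3_eq_zero d
  refine ⟨?_, ξ, -(dot3 ξ u - σ * dot3 ξ B), hξ, ?_, ?_, ?_, ?_⟩
  · ext i j
    simp only [constState, outer, Prod.snd_sub, Prod.fst_sub, Matrix.transpose_apply,
      Matrix.sub_apply, Matrix.add_apply, Matrix.smul_apply, Matrix.of_apply, Matrix.one_apply,
      Pi.add_apply, Pi.sub_apply, Pi.smul_apply, smul_eq_mul, eq_comm (a := j)]
    ring
  · simp only [dot3, Fin.sum_univ_three] at hd
    simp only [constState, dot3, Fin.sum_univ_three, Prod.fst_sub,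
      Pi.add_apply, Pi.sub_apply]
    linear_combination 2 * hd
  · simp only [dot3, Fin.sum_univ_three] at hd
    simp only [constState, dot3, Fin.sum_univ_three, Prod.fst_sub, Prod.snd_sub,
      Pi.add_apply, Pi.sub_apply, Pi.smul_apply, smul_eq_mul]
    linear_combination 2 * σ * hd
  · simp only [dot3, Fin.sum_univ_three] at hd
    ext i
    simp only [constState, outer, Prod.snd_sub, Prod.fst_sub, Matrix.mulVec, dotProduct, dot3,
      Matrix.sub_apply, Matrix.add_apply, Matrix.smul_apply, Matrix.of_apply,
      Pi.add_apply, Pi.sub_apply, Pi.smul_apply, smul_eq_mul, Fin.sum_univ_three, Pi.zero_apply]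
    linear_combination 2 * (u i - σ * B i) * hd
  · simp only [dot3, Fin.sum_univ_three] at hd
    ext i
    fin_cases i <;>
    simp [constState, cross3, dot3, Fin.sum_univ_three]
    · linear_combination 2 * (B 0 - σ * u 0) * hd +
        2 * d 0 * (ξ 0 * B 0 + ξ 1 * B 1 + ξ 2 * B 2) * hσ
    · linear_combination 2 * (B 1 - σ * u 1) * hd +
        2 * d 1 * (ξ 0 * B 0 + ξ 1 * B 1 + ξ 2 * B 2) * hσ
    · linear_combination 2 * (B 2 - σ * u 2) * hd +
        2 * d 2 * (ξ 0 * B 0 + ξ 1 * B 1 + ξ 2 * B 2) * hσ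

theorem constState_eq_midpoint (q σ : ℝ) (hσ : σ ^ 2 = 1) (u B d : V3) :
    constState q u B = (1 / 2 : ℝ) • constState q (u + d) (B + σ • d) +
      (1 - 1 / 2 : ℝ) • constState q (u - d) (B - σ • d) := by
  refine Prod.ext ?_ (Prod.ext ?_ (Prod.ext ?_ ?_))
  · ext i
    simp [constState]
    ring
  · ext i j
    simp only [constState, outer, Prod.snd_add, Prod.fst_add, Prod.smul_fst, Prod.smul_snd,
      Matrix.sub_apply, Matrix.add_apply, Matrix.smul_apply, Matrix.of_apply,
      Pi.add_apply, Pi.sub_apply, Pi.smul_apply, smul_eq_mul]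
    linear_combination d i * d j * hσ
  · ext i
    simp [constState]
    ring
  · ext i
    fin_cases i <;> simp [constState, cross3] <;> ring

theorem constState_mem_lcHull {Y : Set MHDState} {q σ : ℝ} (hσ : σ ^ 2 = 1) {u B d : V3}
    (hp : constState q (u + d) (B + σ • d) ∈ lcHull Y)
    (hm : constState q (u - d) (B - σ • d) ∈ lcHull Y) : constState q u B ∈ lcHull Y := by
  rw [constState_eq_midpoint q σ hσ u B d]
  exact lcHull_of_sub_mem_waveCone hp hm (constState_sub_mem_waveCone q σ hσ u B d)
    (by norm_num) (by norm_num)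

theorem constState_mem_lcHull_Kset_of_eNorm3_eq {r s q : ℝ} (hq : |q| ≤ r * s) {u B : V3}
    (hp : eNorm3 (u + B) = r) (hm : eNorm3 (u - B) ≤ s) :
    constState q u B ∈ lcHull (Kset r s) := by
  obtain ⟨d, h1, h2⟩ := exists_eNorm3_add_sub_eq hm
  refine constState_mem_lcHull (σ := -1) (d := (1 / 2 : ℝ) • d) (by norm_num)
    (mem_lcHull_of_mem ⟨q, hq, rfl, rfl, ?_, ?_⟩) (mem_lcHull_of_mem ⟨q, hq, rfl, rfl, ?_, ?_⟩)
  · rw [← hp]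
    congr 1
    simp only [constState]
    module
  · rw [← h1]
    congr 1
    simp only [constState]
    module
  · rw [← hp]
    congr 1
    simp only [constState]
    module
  · rw [← h2]
    congr 1
    simp only [constState]
    module

theorem constState_mem_lcHull_Kset {r s q : ℝ} (hq : |q| ≤ r * s) {u B : V3}
    (hp : eNorm3 (u + B) ≤ r) (hm : eNorm3 (u - B) ≤ s) :
    constState q u B ∈ lcHull (Kset r s) := by
  obtain ⟨d, h1, h2⟩ := exists_eNorm3_add_sub_eq hp
  refine constState_mem_lcHull (σ := 1) (d := (1 / 2 : ℝ) • d) (by norm_num)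
    (constState_mem_lcHull_Kset_of_eNorm3_eq hq ?_ (le_of_eq_of_le ?_ hm))
    (constState_mem_lcHull_Kset_of_eNorm3_eq hq ?_ (le_of_eq_of_le ?_ hm))
  · rw [← h1]
    congr 1
    module
  · congr 1
    module
  · rw [← h2]
    congr 1
    module
  · congr 1
    module

/-- Relaxation of the normalisation: with ε = min{r−τr, s−τs}, if |u+B| < τr+ε,
|u−B| < τs+ε and |Π| < rs, then (u, u⊗u − B⊗B + Π·Id, B, B×u) ∈ K_{r,s}^{lc,Λ}. -/
theorem stmt13 (r s τ : ℝ) (hr : 0 < r) (hs : 0 < s) (hτ0 : 0 ≤ τ) (hτ1 : τ < 1)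
    (u B : V3) (q : ℝ)
    (hzp : eNorm3 (u + B) < τ * r + min (r - τ * r) (s - τ * s))
    (hzm : eNorm3 (u - B) < τ * s + min (r - τ * r) (s - τ * s))
    (hq : |q| < r * s) :
    (u, outer u u - outer B B + q • (1 : Mat3), B, cross3 B u) ∈
      lcHull (Kset r s) := by
  exact constState_mem_lcHull_Kset hq.le
    (by linarith [min_le_left (r - τ * r) (s - τ * s)])
    (by linarith [min_le_right (r - τ * r) (s - τ * s)])
end
end

section
/- Let r, s > 0. For every τ ∈ [0,1) there exists ε > 0 such that 𝒱_{τr,τs,ε} ⊆ 𝒰_{r,s}. -/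
noncomputable section

theorem eNorm3_eq_norm (a : V3) : eNorm3 a = ‖WithLp.toLp 2 a‖ := by
  simp [eNorm3, EuclideanSpace.norm_eq]

theorem eNorm3_nonneg (a : V3) : 0 ≤ eNorm3 a := Real.sqrt_nonneg _

theorem eNorm3_add_le (a b : V3) : eNorm3 (a + b) ≤ eNorm3 a + eNorm3 b := by
  simpa only [eNorm3_eq_norm, WithLp.toLp_add] using norm_add_le _ _

theorem eNorm3_sub_le (a b : V3) : eNorm3 (a - b) ≤ eNorm3 a + eNorm3 b := by
  simpa only [eNorm3_eq_norm, WithLp.toLp_sub] using norm_sub_le _ _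

theorem eNorm3_smul (c : ℝ) (a : V3) : eNorm3 (c • a) = |c| * eNorm3 a := by
  simp only [eNorm3_eq_norm, WithLp.toLp_smul, norm_smul, Real.norm_eq_abs]

theorem eNorm3_eq_zero_iff (a : V3) : eNorm3 a = 0 ↔ a = 0 := by
  simp [eNorm3_eq_norm]

theorem eNorm3_sq (a : V3) : eNorm3 a ^ 2 = a 0 ^ 2 + a 1 ^ 2 + a 2 ^ 2 := by
  rw [eNorm3, Real.sq_sqrt (Finset.sum_nonneg fun i _ => sq_nonneg _), Fin.sum_univ_three]

theorem exists_ne_zero_orthogonal (a b : V3) :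
    ∃ ξ : V3, ξ ≠ 0 ∧ dot3 ξ a = 0 ∧ dot3 ξ b = 0 := by
  have hdet : (Matrix.of ![a, b, 0] : Mat3).det = 0 :=
    Matrix.det_eq_zero_of_row_eq_zero 2 (by simp)
  obtain ⟨ξ, hξ, h⟩ := Matrix.exists_mulVec_eq_zero_iff.mpr hdet
  refine ⟨ξ, hξ, ?_, ?_⟩
  · have := congrFun h 0
    simpa [Matrix.mulVec, dotProduct, dot3, mul_comm] using this
  · have := congrFun h 1
    simpa [Matrix.mulVec, dotProduct, dot3, mul_comm] using this

theorem exists_orthogonal_of_norm (w : V3) {c : ℝ} (hc : 0 ≤ c) :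
    ∃ a : V3, dot3 a w = 0 ∧ eNorm3 a = c := by
  obtain ⟨ξ, hξ, h, -⟩ := exists_ne_zero_orthogonal w w
  have hn : eNorm3 ξ ≠ 0 := (eNorm3_eq_zero_iff ξ).not.mpr hξ
  refine ⟨(c / eNorm3 ξ) • ξ, ?_, ?_⟩
  · simp only [dot3, Pi.smul_apply, smul_eq_mul, mul_assoc, ← Finset.mul_sum] at h ⊢
    rw [h, mul_zero]
  · rw [eNorm3_smul, abs_of_nonneg (div_nonneg hc (eNorm3_nonneg ξ)), div_mul_cancel₀ _ hn]

theorem eNorm3_add_eq_of_orthogonal {a w : V3} {c : ℝ} (hc : 0 ≤ c) (h : dot3 a w = 0)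
    (hn : eNorm3 a = √(c ^ 2 - eNorm3 w ^ 2)) (hw : eNorm3 w ≤ c) : eNorm3 (w + a) = c := by
  have h0 : 0 ≤ c ^ 2 - eNorm3 w ^ 2 := by nlinarith [eNorm3_nonneg w]
  have h1 : eNorm3 a ^ 2 = c ^ 2 - eNorm3 w ^ 2 := by rw [hn, Real.sq_sqrt h0]
  rw [← sq_eq_sq₀ (eNorm3_nonneg _) hc]
  simp only [eNorm3_sq, dot3, Fin.sum_univ_three, Pi.add_apply] at *
  linarith

/-- Every vector is a cross product of two vectors of length the square root of its norm. -/
theorem exists_cross3_eq (e : V3) : ∃ p q : V3, cross3 q p = e ∧ dot3 e p = 0 ∧ dot3 e q = 0 ∧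
    eNorm3 p ≤ √(eNorm3 e) ∧ eNorm3 q ≤ √(eNorm3 e) := by
  by_cases he : e = 0
  · refine ⟨0, 0, ?_⟩
    subst he
    have h0 : eNorm3 0 = 0 := (eNorm3_eq_zero_iff 0).mpr rfl
    refine ⟨?_, by simp [dot3], by simp [dot3], by simp [h0], by simp [h0]⟩
    ext i
    fin_cases i <;> simp [cross3]
  have hn : 0 < eNorm3 e :=
    lt_of_le_of_ne (eNorm3_nonneg e) (Ne.symm ((eNorm3_eq_zero_iff e).not.mpr he))
  obtain ⟨p, hp, hpn⟩ := exists_orthogonal_of_norm e (Real.sqrt_nonneg (eNorm3 e))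
  have hp2 : eNorm3 p ^ 2 = eNorm3 e := by rw [hpn, Real.sq_sqrt hn.le]
  have hee := eNorm3_sq e
  rw [eNorm3_sq] at hp2
  have hd : e 0 * p 0 + e 1 * p 1 + e 2 * p 2 = 0 := by
    simp only [dot3, Fin.sum_univ_three] at hp
    linarith
  refine ⟨p, (eNorm3 e)⁻¹ • cross3 p e, ?_, ?_, ?_, hpn.le, ?_⟩
  · have key : cross3 (cross3 p e) p = eNorm3 e • e := by
      ext i
      fin_cases i <;> simp [cross3]
      · linear_combination (e 0) * hp2 - p 0 * hd
      · linear_combination (e 1) * hp2 - p 1 * hd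
      · linear_combination (e 2) * hp2 - p 2 * hd
    have hs : cross3 ((eNorm3 e)⁻¹ • cross3 p e) p
        = (eNorm3 e)⁻¹ • cross3 (cross3 p e) p := by
      ext i
      fin_cases i <;> simp [cross3] <;> ring
    rw [hs, key, smul_smul, inv_mul_cancel₀ hn.ne', one_smul]
  · simp only [dot3, Fin.sum_univ_three]
    linarith
  · simp [dot3, Fin.sum_univ_three, cross3]
    ring
  · have key : eNorm3 (cross3 p e) ^ 2 = (eNorm3 e * √(eNorm3 e)) ^ 2 := by
      rw [mul_pow, Real.sq_sqrt hn.le, eNorm3_sq, hee]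
      simp only [cross3, Matrix.cons_val]
      linear_combination (e 0 ^ 2 + e 1 ^ 2 + e 2 ^ 2) * hp2
        - (e 0 * p 0 + e 1 * p 1 + e 2 * p 2) * hd
    rw [sq_eq_sq₀ (eNorm3_nonneg _) (by positivity)] at key
    rw [eNorm3_smul, abs_of_pos (inv_pos.mpr hn), key, inv_mul_cancel_left₀ hn.ne']

theorem midpoint_mem_lcHull {Y : Set MHDState} {V W : MHDState} (hV : V ∈ lcHull Y)
    (hW : W ∈ lcHull Y) (h : V - W ∈ WaveCone) :
    (1 / 2 : ℝ) • V + (1 - 1 / 2 : ℝ) • W ∈ lcHull Y := by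
  obtain ⟨m, hm⟩ := Set.mem_iUnion.mp hV
  obtain ⟨n, hn⟩ := Set.mem_iUnion.mp hW
  refine Set.mem_iUnion.mpr ⟨max m n + 1, Or.inr ⟨1 / 2, V, W, by norm_num, by norm_num,
    lamHull_mono Y (le_max_left m n) hm, lamHull_mono Y (le_max_right m n) hn, h, rfl⟩⟩

/-- The state with velocity `u`, magnetic field `B`, exact electric field and stress defect `R`. -/
def exactState (u B : V3) (R : Mat3) : MHDState :=
  (u, outer u u - outer B B + R, B, cross3 B u)

theorem exactState_sub_mem_waveCone {u B p q ξ : V3} (R : Mat3) (hξ : ξ ≠ 0)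
    (hp : dot3 ξ p = 0) (hq : dot3 ξ q = 0) (hB : dot3 ξ B = 0) :
    exactState (u + p) (B + q) R - exactState (u - p) (B - q) R ∈ WaveCone := by
  simp only [dot3, Fin.sum_univ_three] at hp hq hB
  refine ⟨?_, ξ, -dot3 ξ u, hξ, ?_, ?_, ?_, ?_⟩
  · ext i j
    simp [exactState, outer, Matrix.transpose_apply]
    ring
  · simp [exactState, dot3, Fin.sum_univ_three]
    linear_combination 2 * hp
  · simp [exactState, dot3, Fin.sum_univ_three]
    linear_combination 2 * hq
  · ext i
    simp [exactState, dot3, outer, Fin.sum_univ_three, Matrix.mulVec, dotProduct]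
    linear_combination 2 * u i * hp - 2 * B i * hq - 2 * q i * hB
  · ext i
    fin_cases i <;> simp [exactState, dot3, Fin.sum_univ_three, cross3]
    · linear_combination 2 * B 0 * hp - 2 * u 0 * hq - 2 * p 0 * hB
    · linear_combination 2 * B 1 * hp - 2 * u 1 * hq - 2 * p 1 * hB
    · linear_combination 2 * B 2 * hp - 2 * u 2 * hq - 2 * p 2 * hB

theorem splitting_mem_lcHull {Y : Set MHDState} {u B p q ξ : V3} {R : Mat3} (hξ : ξ ≠ 0)
    (hp : dot3 ξ p = 0) (hq : dot3 ξ q = 0) (hB : dot3 ξ B = 0)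
    (h₁ : exactState (u + p) (B + q) R ∈ lcHull Y)
    (h₂ : exactState (u - p) (B - q) R ∈ lcHull Y) :
    (u, outer u u - outer B B + (R + outer p p - outer q q), B, cross3 B u + cross3 q p)
      ∈ lcHull Y := by
  convert midpoint_mem_lcHull h₁ h₂ (exactState_sub_mem_waveCone R hξ hp hq hB) using 1
  refine Prod.ext ?_ (Prod.ext ?_ (Prod.ext ?_ ?_))
  · ext i
    simp [exactState]
    ring
  · ext i j
    simp [exactState, outer]
    ring
  · ext i
    simp [exactState]
    ring
  · ext i
    fin_cases i <;> simp [exactState, cross3] <;> ring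

/-- All exact states with stress defect `R` and Elsässer variables of size at most `ρ`, `σ`
lie in the lamination hull of `Y`. -/
def DefectAdmissible (Y : Set MHDState) (ρ σ : ℝ) (R : Mat3) : Prop :=
  ∀ u B : V3, eNorm3 (u + B) ≤ ρ → eNorm3 (u - B) ≤ σ → exactState u B R ∈ lcHull Y

theorem defectAdmissible_smul_one {r s q : ℝ} (hr : 0 ≤ r) (hs : 0 ≤ s) (hq : |q| ≤ r * s) :
    DefectAdmissible (Kset r s) r s (q • (1 : Mat3)) := by
  have hzero : ∀ u B : V3, eNorm3 (u + B) = r → eNorm3 (u - B) = s →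
      exactState u B (q • (1 : Mat3)) ∈ lcHull (Kset r s) := fun u B h₁ h₂ =>
    Set.mem_iUnion.mpr ⟨0, q, hq, rfl, rfl, h₁, h₂⟩
  have hplus : ∀ u B : V3, eNorm3 (u + B) ≤ r → eNorm3 (u - B) = s →
      exactState u B (q • (1 : Mat3)) ∈ lcHull (Kset r s) := by
    intro u B h₁ h₂
    obtain ⟨a, ha, han⟩ := exists_orthogonal_of_norm (u + B)
      (Real.sqrt_nonneg (r ^ 2 - eNorm3 (u + B) ^ 2))
    have ha' : dot3 (-a) (u + B) = 0 := by
      simpa [dot3, Finset.sum_neg_distrib] using ha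
    have han' : eNorm3 (-a) = √(r ^ 2 - eNorm3 (u + B) ^ 2) := by
      rw [← han, ← neg_one_smul ℝ a, eNorm3_smul]; simp
    obtain ⟨ξ, hξ, hξa, hξB⟩ := exists_ne_zero_orthogonal ((1 / 2 : ℝ) • a) B
    have := splitting_mem_lcHull (Y := Kset r s) (u := u) (R := q • (1 : Mat3)) hξ hξa hξa hξB
      (hzero _ _ ?_ ?_) (hzero _ _ ?_ ?_)
    · convert this using 1
      refine Prod.ext rfl (Prod.ext ?_ (Prod.ext rfl ?_))
      · simp [exactState]
      · ext i
        fin_cases i <;> simp [exactState, cross3] <;> ring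
    · rw [← eNorm3_add_eq_of_orthogonal hr ha han h₁]
      congr 1; module
    · rw [← h₂]
      congr 1; module
    · rw [← eNorm3_add_eq_of_orthogonal hr ha' han' h₁]
      congr 1; module
    · rw [← h₂]
      congr 1; module
  intro u B h₁ h₂
  obtain ⟨a, ha, han⟩ := exists_orthogonal_of_norm (u - B)
    (Real.sqrt_nonneg (s ^ 2 - eNorm3 (u - B) ^ 2))
  have ha' : dot3 (-a) (u - B) = 0 := by
    simp only [dot3, Pi.neg_apply, neg_mul, Finset.sum_neg_distrib] at ha ⊢
    rw [ha, neg_zero]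
  have han' : eNorm3 (-a) = √(s ^ 2 - eNorm3 (u - B) ^ 2) := by
    rw [← han, ← neg_one_smul ℝ a, eNorm3_smul]; simp
  obtain ⟨ξ, hξ, hξa, hξB⟩ := exists_ne_zero_orthogonal ((1 / 2 : ℝ) • a) B
  have hξa' : dot3 ξ ((-1 / 2 : ℝ) • a) = 0 := by
    simp only [dot3, Fin.sum_univ_three, Pi.smul_apply, smul_eq_mul] at hξa ⊢
    linarith
  have := splitting_mem_lcHull (Y := Kset r s) (u := u) (R := q • (1 : Mat3)) hξ hξa hξa' hξB
    (hplus _ _ ?_ ?_) (hplus _ _ ?_ ?_)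
  · convert this using 1
    refine Prod.ext rfl (Prod.ext ?_ (Prod.ext rfl ?_))
    · ext i j
      simp [exactState, outer]
      ring
    · ext i
      fin_cases i <;> simp [exactState, cross3] <;> ring
  · refine le_of_eq_of_le ?_ h₁
    congr 1; module
  · rw [← eNorm3_add_eq_of_orthogonal hs ha han h₂]
    congr 1; module
  · refine le_of_eq_of_le ?_ h₁
    congr 1; module
  · rw [← eNorm3_add_eq_of_orthogonal hs ha' han' h₂]
    congr 1; module

theorem cross3_zero_left (a : V3) : cross3 0 a = 0 := by
  ext i
  fin_cases i <;> simp [cross3]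

theorem cross3_zero_right (a : V3) : cross3 a 0 = 0 := by
  ext i
  fin_cases i <;> simp [cross3]

theorem DefectAdmissible.add_outer {Y : Set MHDState} {ρ σ η : ℝ} {R : Mat3}
    (h : DefectAdmissible Y ρ σ R) {a : V3} (ha : eNorm3 a ≤ η) :
    DefectAdmissible Y (ρ - η) (σ - η) (R + outer a a) := by
  intro u B h₁ h₂
  obtain ⟨ξ, hξ, hξa, hξB⟩ := exists_ne_zero_orthogonal a B
  have := splitting_mem_lcHull (Y := Y) (u := u) (q := 0) (R := R) hξ hξa (by simp [dot3]) hξB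
    (h _ _ ?_ ?_) (h _ _ ?_ ?_)
  · convert this using 1
    refine Prod.ext rfl (Prod.ext ?_ (Prod.ext rfl ?_))
    · ext i j
      simp [exactState, outer]
    · simp [exactState, cross3_zero_left]
  · have := eNorm3_add_le (u + B) a
    rw [show u + a + (B + 0) = u + B + a by module]
    linarith
  · have := eNorm3_add_le (u - B) a
    rw [show u + a - (B + 0) = u - B + a by module]
    linarith
  · have := eNorm3_sub_le (u + B) a
    rw [show u - a + (B - 0) = u + B - a by module]
    linarith
  · have := eNorm3_sub_le (u - B) a
    rw [show u - a - (B - 0) = u - B - a by module]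
    linarith

theorem DefectAdmissible.sub_outer {Y : Set MHDState} {ρ σ η : ℝ} {R : Mat3}
    (h : DefectAdmissible Y ρ σ R) {a : V3} (ha : eNorm3 a ≤ η) :
    DefectAdmissible Y (ρ - η) (σ - η) (R - outer a a) := by
  intro u B h₁ h₂
  obtain ⟨ξ, hξ, hξa, hξB⟩ := exists_ne_zero_orthogonal a B
  have := splitting_mem_lcHull (Y := Y) (u := u) (p := 0) (R := R) hξ (by simp [dot3]) hξa hξB
    (h _ _ ?_ ?_) (h _ _ ?_ ?_)
  · convert this using 1
    refine Prod.ext rfl (Prod.ext ?_ (Prod.ext rfl ?_))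
    · ext i j
      simp [exactState, outer]
    · simp [exactState, cross3_zero_right]
  · have := eNorm3_add_le (u + B) a
    rw [show u + 0 + (B + a) = u + B + a by module]
    linarith
  · have := eNorm3_sub_le (u - B) a
    rw [show u + 0 - (B + a) = u - B - a by module]
    linarith
  · have := eNorm3_sub_le (u + B) a
    rw [show u - 0 + (B - a) = u + B - a by module]
    linarith
  · have := eNorm3_add_le (u - B) a
    rw [show u - 0 - (B - a) = u - B + a by module]
    linarith

theorem DefectAdmissible.add_smul_outer {Y : Set MHDState} {ρ σ η c : ℝ} {R : Mat3}
    (h : DefectAdmissible Y ρ σ R) {a : V3} (hη : 0 ≤ η) (ha : |c| * eNorm3 a ^ 2 ≤ η ^ 2) :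
    DefectAdmissible Y (ρ - η) (σ - η) (R + c • outer a a) := by
  have hn : eNorm3 (√|c| • a) ≤ η := by
    rw [eNorm3_smul, abs_of_nonneg (Real.sqrt_nonneg _)]
    refine le_of_sq_le_sq ?_ hη
    rwa [mul_pow, Real.sq_sqrt (abs_nonneg c)]
  have ho : outer (√|c| • a) (√|c| • a) = |c| • outer a a := by
    ext i j
    simp only [outer, Matrix.of_apply, Pi.smul_apply, smul_eq_mul, Matrix.smul_apply]
    linear_combination (a i * a j) * Real.mul_self_sqrt (abs_nonneg c)
  rcases abs_cases c with ⟨hc, -⟩ | ⟨hc, -⟩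
  · have := h.add_outer hn
    rwa [ho, hc] at this
  · have := h.sub_outer hn
    rw [ho, hc, neg_smul, sub_neg_eq_add] at this
    exact this

theorem symm_eq_sum_outer {N : Mat3} (hN : N.IsSymm) :
    N = (N 0 0 - N 0 1 - N 0 2) • outer ![1, 0, 0] ![1, 0, 0] +
      (N 1 1 - N 0 1 - N 1 2) • outer ![0, 1, 0] ![0, 1, 0] +
      (N 2 2 - N 0 2 - N 1 2) • outer ![0, 0, 1] ![0, 0, 1] +
      N 0 1 • outer ![1, 1, 0] ![1, 1, 0] + N 0 2 • outer ![1, 0, 1] ![1, 0, 1] +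
      N 1 2 • outer ![0, 1, 1] ![0, 1, 1] := by
  have h₁ := hN.apply 0 1
  have h₂ := hN.apply 0 2
  have h₃ := hN.apply 1 2
  ext i j
  simp only [outer, Matrix.add_apply, Matrix.smul_apply, Matrix.of_apply, smul_eq_mul]
  fin_cases i <;> fin_cases j <;> simp <;> linarith

theorem abs_apply_le_frobNorm (N : Mat3) (i j : Fin 3) : |N i j| ≤ frobNorm N := by
  refine Real.le_sqrt_of_sq_le ?_
  rw [sq_abs]
  exact (Finset.single_le_sum (f := fun j => N i j ^ 2) (fun _ _ => sq_nonneg _)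
    (Finset.mem_univ j)).trans (Finset.single_le_sum (f := fun i => ∑ j, N i j ^ 2)
    (fun _ _ => Finset.sum_nonneg fun _ _ => sq_nonneg _) (Finset.mem_univ i))

theorem DefectAdmissible.add_symm {Y : Set MHDState} {ρ σ δ : ℝ} {R N : Mat3}
    (h : DefectAdmissible Y ρ σ R) (hN : N.IsSymm) (hδ : 0 ≤ δ) (hNδ : frobNorm N ≤ δ ^ 2) :
    DefectAdmissible Y (ρ - 12 * δ) (σ - 12 * δ) (R + N) := by
  have hb : ∀ i j, -δ ^ 2 ≤ N i j ∧ N i j ≤ δ ^ 2 := fun i j => by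
    have := abs_le.mp ((abs_apply_le_frobNorm N i j).trans hNδ)
    exact ⟨by linarith [this.1], this.2⟩
  have hdiag : ∀ {c : ℝ} {a : V3}, |c| ≤ 3 * δ ^ 2 → eNorm3 a ^ 2 = 1 →
      |c| * eNorm3 a ^ 2 ≤ (2 * δ) ^ 2 := fun hc ha => by rw [ha]; nlinarith
  have hoff : ∀ {c : ℝ} {a : V3}, |c| ≤ δ ^ 2 → eNorm3 a ^ 2 = 2 →
      |c| * eNorm3 a ^ 2 ≤ (2 * δ) ^ 2 := fun hc ha => by rw [ha]; nlinarith
  have h2δ : 0 ≤ 2 * δ := by positivity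
  have h00 := hb 0 0
  have h11 := hb 1 1
  have h22 := hb 2 2
  have h01 := hb 0 1
  have h02 := hb 0 2
  have h12 := hb 1 2
  have := ((((((h.add_smul_outer h2δ (c := N 0 0 - N 0 1 - N 0 2) (a := ![1, 0, 0]) (hdiag ?_ ?_)
    ).add_smul_outer h2δ (c := N 1 1 - N 0 1 - N 1 2) (a := ![0, 1, 0]) (hdiag ?_ ?_)
    ).add_smul_outer h2δ (c := N 2 2 - N 0 2 - N 1 2) (a := ![0, 0, 1]) (hdiag ?_ ?_)
    ).add_smul_outer h2δ (c := N 0 1) (a := ![1, 1, 0]) (hoff ?_ ?_)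
    ).add_smul_outer h2δ (c := N 0 2) (a := ![1, 0, 1]) (hoff ?_ ?_)
    ).add_smul_outer h2δ (c := N 1 2) (a := ![0, 1, 1]) (hoff ?_ ?_))
  · rw [symm_eq_sum_outer hN]
    convert this using 1
    · ring
    · ring
    · simp only [add_assoc]
  all_goals first
    | (simp [eNorm3_sq]; done)
    | (simp [eNorm3_sq]; norm_num)
    | (rw [abs_le]; constructor <;> linarith)

theorem mem_lcHull_of_defectAdmissible {Y : Set MHDState} {ρ σ δ : ℝ} {u B E : V3} {R : Mat3}
    (h : DefectAdmissible Y ρ σ R) (hδ : 0 ≤ δ) (hBE : dot3 B E = 0)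
    (he : eNorm3 (E - cross3 B u) ≤ δ ^ 2)
    (h₁ : eNorm3 (u + B) ≤ ρ - 4 * δ) (h₂ : eNorm3 (u - B) ≤ σ - 4 * δ) :
    (u, outer u u - outer B B + R, B, E) ∈ lcHull Y := by
  by_cases h0 : E - cross3 B u = 0
  · rw [sub_eq_zero.mp h0]
    exact h u B (by linarith) (by linarith)
  obtain ⟨p, q, hpq, hep, heq, hp, hq⟩ := exists_cross3_eq (E - cross3 B u)
  have hsqrt : √(eNorm3 (E - cross3 B u)) ≤ δ := (Real.sqrt_le_left hδ).mpr he
  replace hp := hp.trans hsqrt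
  replace hq := hq.trans hsqrt
  have hadm := (h.sub_outer hp).add_outer hq
  have heB : dot3 (E - cross3 B u) B = 0 := by
    simp [dot3, cross3, Fin.sum_univ_three] at hBE ⊢
    linarith
  have b₁ := eNorm3_add_le p q
  have b₂ := eNorm3_sub_le p q
  have := splitting_mem_lcHull (Y := Y) (u := u) h0 hep heq heB
    (hadm _ _ ?_ ?_) (hadm _ _ ?_ ?_)
  · convert this using 1
    refine Prod.ext rfl (Prod.ext ?_ (Prod.ext rfl ?_))
    · simp only [add_right_inj]
      abel
    · simp [hpq]
  · have := eNorm3_add_le (u + B) (p + q)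
    rw [show u + p + (B + q) = u + B + (p + q) by module]
    linarith
  · have := eNorm3_add_le (u - B) (p - q)
    rw [show u + p - (B + q) = u - B + (p - q) by module]
    linarith
  · have := eNorm3_sub_le (u + B) (p + q)
    rw [show u - p + (B - q) = u + B - (p + q) by module]
    linarith
  · have := eNorm3_sub_le (u - B) (p - q)
    rw [show u - p - (B - q) = u - B - (p - q) by module]
    linarith

theorem Vset_subset_lcHull {r s r' s' δ : ℝ} (hr : 0 ≤ r) (hs : 0 ≤ s) (hδ : 0 ≤ δ)
    (h₁ : r' + δ ^ 2 + 16 * δ ≤ r) (h₂ : s' + δ ^ 2 + 16 * δ ≤ s)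
    (h₃ : r' * s' + δ ^ 2 ≤ r * s) : Vset r' s' (δ ^ 2) ⊆ lcHull (Kset r s) := by
  rintro ⟨u, S, B, E⟩ ⟨hS, hBE, q, hp, hm, hN, hq, hE⟩
  dsimp only at hS hBE hp hm hN hE
  have hsymm : (S - (outer u u - outer B B) - q • (1 : Mat3)).IsSymm := by
    ext i j
    have := hS.apply i j
    by_cases hij : i = j
    · subst hij; simp
    · simp [outer, this, hij, Ne.symm hij]
      ring
  have hadm := (defectAdmissible_smul_one hr hs (hq.le.trans h₃)).add_symm hsymm hδ hN.le
  have := mem_lcHull_of_defectAdmissible hadm hδ hBE hE.le (by linarith) (by linarith)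
  convert this using 3
  abel

theorem relOpen_of_isOpen_inter {U O : Set MHDState} (hO : IsOpen O) (h : MSet ∩ O = U) :
    RelOpen U := by
  subst h
  rintro V ⟨-, hV⟩
  have hle : Filter.Tendsto id (Filter.comap (fun W => stateNorm (W - V)) (nhds 0)) (nhds V) := by
    have hlim : Filter.Tendsto (fun W => stateNorm (W - V))
        (Filter.comap (fun W => stateNorm (W - V)) (nhds 0)) (nhds 0) := Filter.tendsto_comap
    have hcoord : ∀ f : MHDState → ℝ, (∀ W, |f W - f V| ≤ stateNorm (W - V)) →
        Filter.Tendsto f (Filter.comap (fun W => stateNorm (W - V)) (nhds 0)) (nhds (f V)) :=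
      fun f hf => tendsto_iff_dist_tendsto_zero.mpr
        (squeeze_zero (fun _ => dist_nonneg) (fun W => by rw [Real.dist_eq]; exact hf W) hlim)
    have hsum : ∀ a : V3, ∀ i, a i ^ 2 ≤ ∑ i, a i ^ 2 := fun a i =>
      Finset.single_le_sum (f := fun i => a i ^ 2) (fun _ _ => sq_nonneg _) (Finset.mem_univ i)
    have hpos : ∀ a : V3, 0 ≤ ∑ i, a i ^ 2 := fun a => Finset.sum_nonneg fun _ _ => sq_nonneg _
    have hMpos : ∀ M : Mat3, 0 ≤ ∑ i, ∑ j, M i j ^ 2 := fun M =>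
      Finset.sum_nonneg fun i _ => hpos (M i)
    have hMsum : ∀ M : Mat3, ∀ i j, M i j ^ 2 ≤ ∑ i, ∑ j, M i j ^ 2 := fun M i j =>
      (hsum (M i) j).trans (Finset.single_le_sum (f := fun i => ∑ j, M i j ^ 2)
        (fun i _ => hpos (M i)) (Finset.mem_univ i))
    refine Filter.Tendsto.prodMk_nhds ?_ (Filter.Tendsto.prodMk_nhds ?_
      (Filter.Tendsto.prodMk_nhds ?_ ?_))
    · refine tendsto_pi_nhds.mpr fun i => hcoord (fun W => W.1 i) fun W => ?_
      refine Real.le_sqrt_of_sq_le ?_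
      rw [sq_abs]
      linarith [hsum (W - V).1 i, hMpos (W - V).2.1, hpos (W - V).2.2.1, hpos (W - V).2.2.2,
        show ((W - V).1 i) ^ 2 = (W.1 i - V.1 i) ^ 2 from rfl]
    · refine tendsto_pi_nhds.mpr fun i => tendsto_pi_nhds.mpr fun j =>
        hcoord (fun W => W.2.1 i j) fun W => ?_
      refine Real.le_sqrt_of_sq_le ?_
      rw [sq_abs]
      linarith [hMsum (W - V).2.1 i j, hpos (W - V).1, hpos (W - V).2.2.1, hpos (W - V).2.2.2,
        show ((W - V).2.1 i j) ^ 2 = (W.2.1 i j - V.2.1 i j) ^ 2 from rfl]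
    · refine tendsto_pi_nhds.mpr fun i => hcoord (fun W => W.2.2.1 i) fun W => ?_
      refine Real.le_sqrt_of_sq_le ?_
      rw [sq_abs]
      linarith [hsum (W - V).2.2.1 i, hMpos (W - V).2.1, hpos (W - V).1, hpos (W - V).2.2.2,
        show ((W - V).2.2.1 i) ^ 2 = (W.2.2.1 i - V.2.2.1 i) ^ 2 from rfl]
    · refine tendsto_pi_nhds.mpr fun i => hcoord (fun W => W.2.2.2 i) fun W => ?_
      refine Real.le_sqrt_of_sq_le ?_
      rw [sq_abs]
      linarith [hsum (W - V).2.2.2 i, hMpos (W - V).2.1, hpos (W - V).1, hpos (W - V).2.2.1,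
        show ((W - V).2.2.2 i) ^ 2 = (W.2.2.2 i - V.2.2.2 i) ^ 2 from rfl]
  obtain ⟨δ, hδ, hsub⟩ := ((Metric.nhds_basis_ball.comap
    (fun W => stateNorm (W - V))).tendsto_left_iff.mp hle) O (hO.mem_nhds hV)
  refine ⟨δ, hδ, fun W hW hWV => ⟨hW, hsub ?_⟩⟩
  have h0 : 0 ≤ stateNorm (W - V) := Real.sqrt_nonneg _
  simpa [abs_of_nonneg h0] using hWV

theorem continuous_outer : Continuous fun a : V3 => outer a a := by
  unfold outer
  fun_prop

theorem continuous_eNorm3 : Continuous eNorm3 := by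
  unfold eNorm3
  fun_prop

theorem continuous_frobNorm : Continuous frobNorm := by
  unfold frobNorm
  fun_prop

theorem continuous_cross3 : Continuous fun x : V3 × V3 => cross3 x.1 x.2 := by
  refine continuous_pi fun i => ?_
  fin_cases i <;> simp [cross3] <;> fun_prop

theorem relOpen_Vset (r' s' c : ℝ) : RelOpen (Vset r' s' c) := by
  refine relOpen_of_isOpen_inter (O := ⋃ q : ℝ, {V : MHDState |
    eNorm3 (V.1 + V.2.2.1) < r' + c ∧ eNorm3 (V.1 - V.2.2.1) < s' + c ∧
    frobNorm (V.2.1 - (outer V.1 V.1 - outer V.2.2.1 V.2.2.1) - q • (1 : Mat3)) < c ∧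
    |q| < r' * s' + c ∧ eNorm3 (V.2.2.2 - cross3 V.2.2.1 V.1) < c}) (isOpen_iUnion fun q => ?_) ?_
  · have hu : Continuous fun V : MHDState => outer V.1 V.1 :=
      continuous_outer.comp continuous_fst
    have hB : Continuous fun V : MHDState => outer V.2.2.1 V.2.2.1 :=
      continuous_outer.comp (by fun_prop)
    have hBu : Continuous fun V : MHDState => cross3 V.2.2.1 V.1 :=
      continuous_cross3.comp (f := fun V : MHDState => (V.2.2.1, V.1)) (by fun_prop)
    have hR : Continuous fun V : MHDState =>
        V.2.1 - (outer V.1 V.1 - outer V.2.2.1 V.2.2.1) - q • (1 : Mat3) := by fun_prop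
    have hp : Continuous fun V : MHDState => V.1 + V.2.2.1 := by fun_prop
    have hm : Continuous fun V : MHDState => V.1 - V.2.2.1 := by fun_prop
    have he : Continuous fun V : MHDState => V.2.2.2 - cross3 V.2.2.1 V.1 := by fun_prop
    refine (isOpen_lt (continuous_eNorm3.comp hp) continuous_const).and
      ((isOpen_lt (continuous_eNorm3.comp hm) continuous_const).and
      ((isOpen_lt (continuous_frobNorm.comp hR) continuous_const).and
      ((isOpen_lt continuous_const continuous_const).and
      (isOpen_lt (continuous_eNorm3.comp he) continuous_const))))
  · ext V
    simp only [MSet, Vset, Set.mem_inter_iff, Set.mem_iUnion, Set.mem_ofPred_eq, and_assoc]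

/-- For every τ ∈ [0,1) there exists ε > 0 such that 𝒱_{τr,τs,ε} ⊆ 𝒰_{r,s}. -/
theorem stmt14 (r s : ℝ) (hr : 0 < r) (hs : 0 < s)
    (τ : ℝ) (hτ0 : 0 ≤ τ) (hτ1 : τ < 1) :
    ∃ ε : ℝ, 0 < ε ∧ Vset (τ * r) (τ * s) ε ⊆ Uset r s := by
  have hr' : 0 < (1 - τ) * r := mul_pos (by linarith) hr
  have hs' : 0 < (1 - τ) * s := mul_pos (by linarith) hs
  have hrs : 0 < (1 - τ) * (r * s) := mul_pos (by linarith) (mul_pos hr hs)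
  obtain ⟨δ, hδ, hδ1, hδr, hδs, hδrs⟩ : ∃ δ : ℝ, 0 < δ ∧ δ ≤ 1 ∧ 17 * δ ≤ (1 - τ) * r ∧
      17 * δ ≤ (1 - τ) * s ∧ δ ≤ (1 - τ) * (r * s) := by
    refine ⟨min (min 1 ((1 - τ) * (r * s))) (min ((1 - τ) * r / 17) ((1 - τ) * s / 17)),
      by positivity, ?_, ?_, ?_, ?_⟩
    · exact (min_le_left _ _).trans (min_le_left _ _)
    · rw [← le_div_iff₀' (by norm_num)]
      exact (min_le_right _ _).trans (min_le_left _ _)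
    · rw [← le_div_iff₀' (by norm_num)]
      exact (min_le_right _ _).trans (min_le_right _ _)
    · exact (min_le_left _ _).trans (min_le_right _ _)
  have hsq : δ ^ 2 ≤ δ := by nlinarith
  have hτrs : τ * r * (τ * s) ≤ τ * (r * s) := by
    have : 0 ≤ τ * (1 - τ) * (r * s) :=
      mul_nonneg (mul_nonneg hτ0 (by linarith)) (mul_pos hr hs).le
    linarith
  have hsub := Vset_subset_lcHull hr.le hs.le hδ.le (r' := τ * r) (s' := τ * s) (by linarith)
    (by linarith) (by linarith)
  refine ⟨δ ^ 2, by positivity, fun V hV => ⟨⟨hV.1, hV.2.1⟩, ?_⟩⟩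
  obtain ⟨η, hη, h⟩ := relOpen_Vset _ _ _ V hV
  exact ⟨η, hη, fun W hW hWV => hsub (h W hW hWV)⟩
end
end

section
/- Let ξ ∈ ℝ⁴ with (ξ₁,ξ₂,ξ₃) ≠ 0, and let U be a symmetric 4×4 real matrix with U₄₄ = 0 and Uξ = 0. Then there exists a map P : ℝ⁴ → ℝ^{4×4}, each of whose entries is a homogeneous quadratic polynomial in η (equivalently, P(η) = Q(η,η) for some symmetric bilinear map Q : ℝ⁴ × ℝ⁴ → ℝ^{4×4}), such that for every η ∈ ℝ⁴ the matrix P(η) is symmetric, P(η)η = 0 and (P(η))₄₄ = 0, and moreover P(ξ) = U. -/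
noncomputable section

/-- Vectors in ℝ⁴. -/
abbrev V4 : Type := Fin 4 → ℝ

/-- 4×4 real matrices. -/
abbrev Mat4 : Type := Matrix (Fin 4) (Fin 4) ℝ

/-- ξ ∈ (ℝ³∖{0})×ℝ: the first three coordinates of ξ are not all zero. -/
def spatialNonzero (ξ : V4) : Prop := ¬(ξ 0 = 0 ∧ ξ 1 = 0 ∧ ξ 2 = 0)

/-- The matrix `(s ⬝ η) I - s ηᵀ`, whose transpose annihilates `η`. -/
def annihilator (s η : V4) : Mat4 := (s ⬝ᵥ η) • (1 : Mat4) - Matrix.vecMulVec s η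

lemma annihilator_add (s a b : V4) :
    annihilator s (a + b) = annihilator s a + annihilator s b := by
  simp only [annihilator, dotProduct_add, Matrix.vecMulVec_add, add_smul]
  abel

lemma annihilator_smul (s : V4) (c : ℝ) (a : V4) :
    annihilator s (c • a) = c • annihilator s a := by
  simp only [annihilator, dotProduct_smul, Matrix.vecMulVec_smul, smul_sub, smul_assoc]

lemma annihilator_transpose_mulVec (s η : V4) :
    (annihilator s η).transpose.mulVec η = 0 := by
  simp [annihilator, Matrix.sub_mulVec, Matrix.smul_mulVec, Matrix.transpose_vecMulVec,
    Matrix.vecMulVec_mulVec]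

lemma annihilator_mul_of_mulVec_eq_zero (s ξ : V4) (U : Mat4) (hsym : U.IsSymm)
    (hker : U.mulVec ξ = 0) : annihilator s ξ * U = (s ⬝ᵥ ξ) • U := by
  have h : Matrix.vecMul ξ U = 0 := by
    rw [← Matrix.mulVec_transpose, hsym.eq, hker]
  simp [annihilator, Matrix.sub_mul, Matrix.vecMulVec_mul, h]

/-- The symmetrization of `(a, b) ↦ c M(a) U M(b)ᵀ`, with `M = annihilator s`. -/
def potential (c : ℝ) (s : V4) (U : Mat4) : V4 →ₗ[ℝ] V4 →ₗ[ℝ] Mat4 :=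
  LinearMap.mk₂ ℝ
    (fun a b => (c / 2) • (annihilator s a * U * (annihilator s b).transpose +
      annihilator s b * U * (annihilator s a).transpose))
    (fun a a' b => by
      simp only [annihilator_add, Matrix.add_mul, Matrix.mul_add, Matrix.transpose_add, smul_add]
      abel)
    (fun r a b => by
      simp only [annihilator_smul, Matrix.smul_mul, Matrix.mul_smul, Matrix.transpose_smul,
        ← smul_add, smul_comm r])
    (fun a b b' => by
      simp only [annihilator_add, Matrix.add_mul, Matrix.mul_add, Matrix.transpose_add, smul_add]
      abel)
    (fun r a b => by
      simp only [annihilator_smul, Matrix.smul_mul, Matrix.mul_smul, Matrix.transpose_smul,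
        ← smul_add, smul_comm r])

lemma potential_comm (c : ℝ) (s : V4) (U : Mat4) (a b : V4) :
    potential c s U a b = potential c s U b a := by
  simp only [potential, LinearMap.mk₂_apply, add_comm]

lemma potential_self (c : ℝ) (s : V4) (U : Mat4) (η : V4) :
    potential c s U η η = c • (annihilator s η * U * (annihilator s η).transpose) := by
  simp only [potential, LinearMap.mk₂_apply, ← two_smul ℝ (annihilator s η * U * _), smul_smul]
  congr 1
  ring

/-- Let ξ ∈ ℝ⁴ with (ξ₁,ξ₂,ξ₃) ≠ 0 and let U be a symmetric 4×4 matrix with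
U₄₄ = 0 and Uξ = 0.  Then there is a matrix-valued map η ↦ P(η) = Q(η,η), with Q
a symmetric bilinear map, such that for all η the matrix P(η) is symmetric,
P(η)η = 0 and P(η)₄₄ = 0, and P(ξ) = U. -/
theorem stmt17 (ξ : V4) (hξ : spatialNonzero ξ) (U : Mat4)
    (hsym : U.IsSymm) (h44 : U 3 3 = 0) (hker : U.mulVec ξ = 0) :
    ∃ Q : V4 →ₗ[ℝ] V4 →ₗ[ℝ] Mat4,
      (∀ a b : V4, Q a b = Q b a) ∧
      (∀ η : V4, (Q η η).IsSymm ∧ (Q η η).mulVec η = 0 ∧ (Q η η) 3 3 = 0) ∧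
      Q ξ ξ = U := by
  set s : V4 := ![ξ 0, ξ 1, ξ 2, 0] with hs
  have hn : s ⬝ᵥ ξ ≠ 0 := by
    intro h
    have h' : ξ 0 * ξ 0 + ξ 1 * ξ 1 + ξ 2 * ξ 2 = 0 := by
      simpa [hs, dotProduct, Fin.sum_univ_four] using h
    refine hξ ⟨?_, ?_, ?_⟩ <;>
      nlinarith [mul_self_nonneg (ξ 0), mul_self_nonneg (ξ 1), mul_self_nonneg (ξ 2)]
  refine ⟨potential ((s ⬝ᵥ ξ)⁻¹ ^ 2) s U, potential_comm _ _ _, fun η => ⟨?_, ?_, ?_⟩, ?_⟩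
  · rw [potential_self]
    refine Matrix.IsSymm.smul ?_ _
    simp only [Matrix.IsSymm, Matrix.transpose_mul, Matrix.transpose_transpose, hsym.eq,
      Matrix.mul_assoc]
  · rw [potential_self, Matrix.smul_mulVec, ← Matrix.mulVec_mulVec,
      annihilator_transpose_mulVec, Matrix.mulVec_zero, smul_zero]
  · have hrow (j : Fin 4) : annihilator s η 3 j = (s ⬝ᵥ η) * (1 : Mat4) 3 j := by
      have hs3 : s 3 = 0 := rfl
      rw [annihilator, Matrix.sub_apply, Matrix.smul_apply, Matrix.vecMulVec_apply, hs3,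
        zero_mul, sub_zero, smul_eq_mul]
    simp [potential_self, Matrix.mul_apply, hrow, Matrix.one_apply, h44]
  · have hleft := annihilator_mul_of_mulVec_eq_zero s ξ U hsym hker
    have hright : U * (annihilator s ξ).transpose = (s ⬝ᵥ ξ) • U := by
      have := congrArg Matrix.transpose hleft
      rwa [Matrix.transpose_mul, Matrix.transpose_smul, hsym.eq] at this
    rw [potential_self, hleft, Matrix.smul_mul, hright, smul_smul, smul_smul]
    convert one_smul ℝ U using 2
    field_simp
end
end
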